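/- arXiv:2411.15109 — 3 statements merged into one kernel-verified Lean document; each statement's English description precedes it below -/
import Mathlib

section
/- Every hypothesis class H of finite effective Littlestone dimension consists entirely of computable functions. -/
/-- A sample: a finite sequence of (point, label) pairs. -/
abbrev Sample := List (ℕ × Bool)

/-- A sample is consistent with `f` if `f` agrees with every labeled pair. -/
def Consistent (f : ℕ → Bool) (S : Sample) : Prop := ∀ p ∈ S, f p.1 = p.2

/-- A sample is realizable by `H` if some function in `H` is consistent with it. -/
def Realizable (H : Set (ℕ → Bool)) (S : Sample) : Prop := ∃ f ∈ H, Consistent f S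

/-- A (total) learner maps a sample and a query point to a prediction. -/
abbrev Learner := Sample → ℕ → Bool

/-- Number of sequential prediction mistakes of learner `L` on sample `S`. -/
def mistakes (L : Learner) (S : Sample) : ℕ :=
  (List.range S.length).countP fun i =>
    decide (L (S.take i) (S.getD i (0, false)).1 ≠ (S.getD i (0, false)).2)

/-- Code of a Littlestone tree: association list assigning labels to nodes
(nodes are indexed by the bit-path leading to them; missing nodes get label 0). -/
abbrev TreeCode := List (List Bool × ℕ)

/-- Label of the node reached by path `p` in the tree coded by `T`. -/
def nodeLabel (T : TreeCode) (p : List Bool) : ℕ := (T.lookup p).getD 0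

/-- The sample written along the branch `p` (a list of edge bits) in the tree `T`. -/
def branchSample (T : TreeCode) (p : List Bool) : Sample :=
  (List.range p.length).map fun i => (nodeLabel T (p.take i), p.getD i false)

/-- `H` has Littlestone dimension at most `d`: every Littlestone tree of depth `d+1`
has a leaf whose branch sample is not `H`-realizable. -/
def LdimLe (H : Set (ℕ → Bool)) (d : ℕ) : Prop :=
  ∀ T : TreeCode, ∃ p : List Bool, p.length = d + 1 ∧ ¬ Realizable H (branchSample T p)

/-- The Littlestone dimension of `H` (`⊤` if infinite). -/
noncomputable def Ldim (H : Set (ℕ → Bool)) : ℕ∞ :=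
  sInf ((↑) '' {d : ℕ | LdimLe H d})

/-- `H` has effective Littlestone dimension at most `d`: a total computable function
indicates, in every depth-`(d+1)` Littlestone tree, a leaf that is not `H`-realizable. -/
def EldimLe (H : Set (ℕ → Bool)) (d : ℕ) : Prop :=
  ∃ A : TreeCode → List Bool, Computable A ∧
    ∀ T, (A T).length = d + 1 ∧ ¬ Realizable H (branchSample T (A T))

/-- The effective Littlestone dimension of `H` (`⊤` if infinite). -/
noncomputable def Eldim (H : Set (ℕ → Bool)) : ℕ∞ :=
  sInf ((↑) '' {d : ℕ | EldimLe H d})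

/-- The cylinder induced by a sample: all functions consistent with it. -/
def Cyl (S : Sample) : Set (ℕ → Bool) := {f | Consistent f S}

/-- Effectively open subset of Cantor space: union of a computably enumerated
family of cylinders. -/
def EffOpen (X : Set (ℕ → Bool)) : Prop :=
  ∃ g : ℕ → Sample, Computable g ∧ X = ⋃ n, Cyl (g n)

/-- Effectively closed subset of Cantor space: complement is effectively open. -/
def EffClosed (X : Set (ℕ → Bool)) : Prop := EffOpen Xᶜ

/-! ### Consistency -/

theorem consistent_append {f : ℕ → Bool} {S S' : Sample} :
    Consistent f (S ++ S') ↔ Consistent f S ∧ Consistent f S' := by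
  simp only [Consistent, List.mem_append]
  exact ⟨fun h => ⟨fun p hp => h p (Or.inl hp), fun p hp => h p (Or.inr hp)⟩,
    fun h p hp => hp.elim (h.1 p) (h.2 p)⟩

theorem consistent_cons {f : ℕ → Bool} {x : ℕ} {b : Bool} {S : Sample} :
    Consistent f ((x, b) :: S) ↔ f x = b ∧ Consistent f S := by
  simp [Consistent]

theorem consistent_nil (f : ℕ → Bool) : Consistent f [] := by
  simp [Consistent]

/-! ### Effectively closed classes -/

theorem EffClosed.inter_cyl {X : Set (ℕ → Bool)} (hX : EffClosed X) (S : Sample) :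
    EffClosed (X ∩ Cyl S) := by
  obtain ⟨g, hg, hXg⟩ := hX
  have hXg' : ∀ f, f ∈ X ↔ ∀ n, ¬ Consistent f (g n) := fun f => by
    have := Set.ext_iff.1 hXg f
    simp only [Set.mem_compl_iff, Set.mem_iUnion, Cyl, Set.mem_ofPred_eq] at this
    rw [← not_exists, ← this, not_not]
  induction S with
  | nil =>
    refine ⟨g, hg, ?_⟩
    rw [← hXg]
    congr 1
    ext f
    simp [Cyl, consistent_nil]
  | cons a S ih =>
    obtain ⟨g', hg', h'⟩ := ih
    refine ⟨fun n => Nat.casesOn n [(a.1, !a.2)] g', ?_, ?_⟩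
    · exact Computable.nat_casesOn Computable.id (Computable.const _)
        (hg'.comp Computable.snd).to₂
    · ext f
      have := Set.ext_iff.1 h' f
      simp only [Set.mem_compl_iff, Set.mem_iUnion, Cyl, Set.mem_ofPred_eq, Set.mem_inter_iff]
        at this ⊢
      obtain ⟨x, b⟩ := a
      rw [consistent_cons]
      constructor
      · intro h
        by_cases hb : f x = b
        · obtain ⟨n, hn⟩ := this.1 (by tauto)
          exact ⟨n + 1, hn⟩
        · refine ⟨0, ?_⟩
          change Consistent f [(x, !b)]
          rw [consistent_cons]
          exact ⟨by cases b <;> simpa using hb, consistent_nil f⟩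
      · rintro ⟨n, hn⟩ ⟨h1, h2, h3⟩
        cases n with
        | zero =>
          have : f x = !b := (consistent_cons.1 (show Consistent f [(x, !b)] from hn)).1
          rw [h2] at this
          cases b <;> simp at this
        | succ n => exact this.2 ⟨n, hn⟩ ⟨h1, h3⟩

/-- The graph of `f` restricted to arguments below `n`. -/
def graphBelow (f : ℕ → Bool) (n : ℕ) : Sample := (List.range n).map fun k => (k, f k)

/-- The list of all graphs of functions on arguments below `n`. -/
def allGraphs (n : ℕ) : List Sample :=
  Nat.rec [[]] (fun k L => L.flatMap fun σ => [σ ++ [(k, false)], σ ++ [(k, true)]]) n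

theorem mem_graphBelow {f : ℕ → Bool} {n : ℕ} {p : ℕ × Bool} :
    p ∈ graphBelow f n ↔ p.1 < n ∧ f p.1 = p.2 := by
  obtain ⟨x, b⟩ := p
  simp [graphBelow]

theorem graphBelow_congr {f g : ℕ → Bool} {n : ℕ} (h : ∀ k < n, f k = g k) :
    graphBelow f n = graphBelow g n := by
  simp only [graphBelow, List.map_inj_left, List.mem_range, Prod.mk.injEq, true_and]
  exact h

theorem graphBelow_succ (f : ℕ → Bool) (n : ℕ) :
    graphBelow f (n + 1) = graphBelow f n ++ [(n, f n)] := by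
  simp [graphBelow, List.range_succ]

theorem mem_allGraphs {n : ℕ} {σ : Sample} : σ ∈ allGraphs n ↔ ∃ f, σ = graphBelow f n := by
  induction n generalizing σ with
  | zero => simp [allGraphs, graphBelow]
  | succ n ih =>
    change σ ∈ (allGraphs n).flatMap _ ↔ _
    simp only [List.mem_flatMap, List.mem_cons, List.not_mem_nil, or_false, ih]
    constructor
    · have key : ∀ (f : ℕ → Bool) b,
          graphBelow f n ++ [(n, b)] = graphBelow (Function.update f n b) (n + 1) := fun f b => by
        rw [graphBelow_succ, Function.update_self]
        congr 1
        exact graphBelow_congr fun k hk => by simp [hk.ne]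
      rintro ⟨_, ⟨f, rfl⟩, rfl | rfl⟩
      exacts [⟨_, key _ _⟩, ⟨_, key _ _⟩]
    · rintro ⟨f, rfl⟩
      refine ⟨_, ⟨f, rfl⟩, ?_⟩
      rw [graphBelow_succ]
      cases f n <;> simp

theorem primrec_allGraphs : Primrec allGraphs := by
  refine Primrec.nat_rec₁ [[]] (f := fun (k : ℕ) (L : List Sample) =>
    L.flatMap fun σ => [σ ++ [(k, false)], σ ++ [(k, true)]]) ?_
  have key : ∀ b : Bool, Primrec₂ fun (q : ℕ × List Sample) (σ : Sample) => σ ++ [(q.1, b)] :=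
    fun b => Primrec.list_append.comp Primrec.snd
      (Primrec.list_cons.comp (Primrec.pair (Primrec.fst.comp Primrec.fst) (Primrec.const b))
        (Primrec.const []))
  exact Primrec.list_flatMap Primrec.snd
    (Primrec.list_cons.comp (key false) (Primrec.list_cons.comp (key true) (Primrec.const [])))

/-- The property of a table `σ` of containing a clause from `G` or the pair `p`. -/
def Covered (σ : Sample) (q : List Sample × (ℕ × Bool)) : Prop :=
  (∃ c ∈ q.1, ∀ r ∈ c, ∃ s ∈ σ, s = r) ∨ ∃ s ∈ σ, s = q.2

theorem primrecRel_covered : PrimrecRel Covered := by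
  have h0 : PrimrecRel fun (s r : ℕ × Bool) => s = r := Primrec.eq
  have h1 : PrimrecRel fun (σ : Sample) (r : ℕ × Bool) => ∃ s ∈ σ, s = r := h0.exists_mem_list
  have h2 : PrimrecRel fun (r : ℕ × Bool) (σ : Sample) => ∃ s ∈ σ, s = r :=
    h1.comp Primrec.snd Primrec.fst
  have h3 := h2.forall_mem_list.exists_mem_list
  exact (h3.comp (Primrec.fst.comp Primrec.snd) Primrec.fst).or
    (h1.comp Primrec.fst (Primrec.snd.comp Primrec.snd))

/-- An isolated member of an effectively closed class is computable. -/
theorem EffClosed.computable_of_unique {X : Set (ℕ → Bool)} (hX : EffClosed X) {f : ℕ → Bool}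
    (hf : f ∈ X) (huniq : ∀ h ∈ X, h = f) : Computable f := by
  classical
  obtain ⟨g, hg, hXg⟩ := hX
  have hXg' : ∀ f, f ∈ X ↔ ∀ n, ¬ Consistent f (g n) := fun f => by
    have := Set.ext_iff.1 hXg f
    simp only [Set.mem_compl_iff, Set.mem_iUnion, Cyl, Set.mem_ofPred_eq] at this
    rw [← not_exists, ← this, not_not]
  let G : ℕ → List Sample := fun N => Nat.rec [] (fun k L => g k :: L) N
  have hG : ∀ N c, c ∈ G N ↔ ∃ k < N, g k = c := by
    intro N c
    induction N with
    | zero => simp [G]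
    | succ N ih =>
      change c ∈ g N :: G N ↔ _
      rw [List.mem_cons, ih]
      constructor
      · rintro (rfl | ⟨k, hk, rfl⟩)
        exacts [⟨N, by omega, rfl⟩, ⟨k, by omega, rfl⟩]
      · rintro ⟨k, hk, rfl⟩
        rcases Nat.lt_succ_iff_lt_or_eq.1 hk with h | rfl
        exacts [Or.inr ⟨k, h, rfl⟩, Or.inl rfl]
  have hGc : Computable G :=
    Computable.nat_rec Computable.id (Computable.const [])
      (Computable.list_cons.comp (hg.comp (Computable.fst.comp Computable.snd))
        (Computable.snd.comp Computable.snd)).to₂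
  let Q : ℕ → Bool → ℕ → Prop := fun x b N => ∀ σ ∈ allGraphs N, Covered σ (G N, (x, b))
  have hQc : ∀ b, Computable₂ fun x N => decide (Q x b N) := by
    intro b
    have h := (primrecRel_covered.forall_mem_list).decide.to_comp
    exact (h.comp (primrec_allGraphs.to_comp.comp Computable.snd)
      (Computable.pair (hGc.comp Computable.snd)
        (Computable.pair Computable.fst (Computable.const b)))).of_eq
      fun p => by simp only [Q]
  have hsound : ∀ x b N, Q x b N → f x = b := by
    intro x b N h
    rcases h (graphBelow f N) (mem_allGraphs.2 ⟨f, rfl⟩) with ⟨c, hc, hcσ⟩ | ⟨s, hs, rfl⟩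
    · obtain ⟨k, -, rfl⟩ := (hG N c).1 hc
      refine absurd ?_ ((hXg' f).1 hf k)
      intro p hp
      obtain ⟨s, hs, rfl⟩ := hcσ p hp
      exact (mem_graphBelow.1 hs).2
    · exact (mem_graphBelow.1 hs).2
  have hcomplete : ∀ x, ∃ N, Q x (f x) N := by
    intro x
    by_contra! hcon
    let K : ℕ → Set (ℕ → Bool) := fun N => {h | ¬ Covered (graphBelow h N) (G N, (x, f x))}
    have hK : (⋂ N, K N).Nonempty := by
      apply IsCompact.nonempty_iInter_of_sequence_nonempty_isCompact_isClosed
      · intro N h hh hcov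
        apply hh
        have mono : ∀ p, p ∈ graphBelow h N → p ∈ graphBelow h (N + 1) := fun p hp => by
          rw [mem_graphBelow] at hp ⊢
          exact ⟨by omega, hp.2⟩
        rcases hcov with ⟨c, hc, hcσ⟩ | ⟨s, hs, rfl⟩
        · refine Or.inl ⟨c, List.mem_cons_of_mem _ hc, fun r hr => ?_⟩
          obtain ⟨s, hs, rfl⟩ := hcσ r hr
          exact ⟨s, mono _ hs, rfl⟩
        · exact Or.inr ⟨_, mono _ hs, rfl⟩
      · intro N
        have := hcon N
        simp only [Q, not_forall] at this
        obtain ⟨σ, hσ, h⟩ := this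
        obtain ⟨h', rfl⟩ := mem_allGraphs.1 hσ
        exact ⟨h', h⟩
      · apply IsClosed.isCompact
        simp [K, Covered, G, graphBelow]
      · intro N
        let ρ : (ℕ → Bool) → (Fin N → Bool) := fun h k => h k
        have hρ : Continuous ρ := by fun_prop
        have : K N = ρ ⁻¹' {u | ¬ Covered
            (graphBelow (fun k => if hk : k < N then u ⟨k, hk⟩ else false) N)
            (G N, (x, f x))} := by
          ext h
          simp only [K, Set.mem_ofPred_eq, Set.mem_preimage]
          rw [graphBelow_congr]
          intro k hk
          simp [hk, ρ]
        rw [this]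
        exact (isClosed_discrete _).preimage hρ
    obtain ⟨h, hh⟩ := hK
    rw [Set.mem_iInter] at hh
    have hhX : h ∈ X := by
      rw [hXg']
      intro n hn
      obtain ⟨m, hm⟩ : ∃ m, ∀ p ∈ g n, p.1 < m := by
        refine ⟨((g n).map Prod.fst).sum + 1, fun p hp => ?_⟩
        have := List.single_le_sum (l := (g n).map Prod.fst) (by simp) p.1
          (List.mem_map_of_mem hp)
        omega
      refine hh (max m (n + 1)) (Or.inl ⟨g n, (hG _ _).2 ⟨n, by simp, rfl⟩, fun r hr => ?_⟩)
      exact ⟨r, mem_graphBelow.2 ⟨lt_max_of_lt_left (hm r hr), hn r hr⟩, rfl⟩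
    have := huniq h hhX
    subst this
    exact hh (x + 1) (Or.inr ⟨_, mem_graphBelow.2 ⟨Nat.lt_succ_self x, rfl⟩, rfl⟩)
  let o : ℕ → ℕ → Option Bool := fun x N =>
    bif decide (Q x true N) then some true else bif decide (Q x false N) then some false else none
  have ho : Computable₂ o :=
    Computable.cond (hQc true) (Computable.const _)
      (Computable.cond (hQc false) (Computable.const _) (Computable.const _))
  have hoval : ∀ x N b, b ∈ o x N → b = f x := by
    intro x N b hb
    by_cases h1 : Q x true N
    · have : true = b := by simpa [o, h1] using hb
      rw [← this, hsound x true N h1]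
    · by_cases h2 : Q x false N
      · have : false = b := by simpa [o, h1, h2] using hb
        rw [← this, hsound x false N h2]
      · simp [o, h1, h2] at hb
  refine (Partrec.rfindOpt ho).of_eq_tot fun x => ?_
  have hdom : (Nat.rfindOpt (o x)).Dom := by
    rw [Nat.rfindOpt_dom]
    obtain ⟨N, hN⟩ := hcomplete x
    by_cases h1 : Q x true N
    · exact ⟨N, true, by simp [o, h1]⟩
    · cases hfx : f x
      · rw [hfx] at hN
        exact ⟨N, false, by simp [o, h1, hN]⟩
      · rw [hfx] at hN
        exact absurd hN h1
  obtain ⟨b, hb⟩ := Part.dom_iff_mem.1 hdom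
  obtain ⟨N, hN⟩ := Nat.rfindOpt_spec hb
  rwa [← hoval x N b hN]

/-! ### Shattered trees -/

/-- Among the members of `H` consistent with `S`, a Littlestone tree of depth `n` is shattered. -/
def Shatters (H : Set (ℕ → Bool)) : ℕ → Sample → Prop
  | 0, S => Realizable H S
  | n + 1, S => ∃ x, ∀ b, Shatters H n ((x, b) :: S)

theorem Shatters.of_realizable {H H' : Set (ℕ → Bool)} {n : ℕ} {S S' : Sample}
    (hsub : ∀ R, Realizable H (R ++ S) → Realizable H' (R ++ S'))
    (h : Shatters H n S) : Shatters H' n S' := by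
  induction n generalizing S S' with
  | zero => exact hsub [] h
  | succ n ih =>
    obtain ⟨x, hx⟩ := h
    refine ⟨x, fun b => ih (fun R hR => ?_) (hx b)⟩
    simpa using hsub (R ++ [(x, b)]) (by simpa using hR)

theorem Shatters.mono {H H' : Set (ℕ → Bool)} {n : ℕ} {S : Sample} (hsub : H ⊆ H')
    (h : Shatters H n S) : Shatters H' n S :=
  h.of_realizable fun _ ⟨f, hf, hc⟩ => ⟨f, hsub hf, hc⟩

theorem Shatters.of_inter_cyl {H : Set (ℕ → Bool)} {n : ℕ} {S : Sample}
    (h : Shatters (H ∩ Cyl S) n []) : Shatters H n S :=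
  h.of_realizable fun _ ⟨f, hf, hc⟩ =>
    ⟨f, hf.1, consistent_append.2 ⟨(consistent_append.1 hc).1, hf.2⟩⟩

/-- A shattered tree is shattered by finitely many functions, all consistent with the sample. -/
theorem Shatters.exists_list {H : Set (ℕ → Bool)} {n : ℕ} {S : Sample} (h : Shatters H n S) :
    ∃ G : List (ℕ → Bool), (∀ g ∈ G, g ∈ H ∧ Consistent g S) ∧ Shatters {g | g ∈ G} n S := by
  induction n generalizing S with
  | zero =>
    obtain ⟨f, hf, hc⟩ := h
    exact ⟨[f], by simpa using ⟨hf, hc⟩, f, by simp, hc⟩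
  | succ n ih =>
    obtain ⟨x, hx⟩ := h
    choose G hG hGs using fun b => ih (hx b)
    refine ⟨G false ++ G true, fun g hg => ?_, x, fun b => (hGs b).mono fun g hg => ?_⟩
    · rcases List.mem_append.1 hg with hg | hg
      · exact ⟨(hG _ g hg).1, (consistent_cons.1 (hG _ g hg).2).2⟩
      · exact ⟨(hG _ g hg).1, (consistent_cons.1 (hG _ g hg).2).2⟩
    · cases b
      · exact List.mem_append_left _ hg
      · exact List.mem_append_right _ hg

/-- A long threshold pattern shatters deep trees. -/
theorem shatters_of_thresholds {H : Set (ℕ → Bool)} {f : ℕ → Bool} {g : ℕ → ℕ → Bool} {x : ℕ → ℕ}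
    (hg : ∀ i, g i ∈ H) (hlt : ∀ i j, i < j → g i (x j) ≠ f (x j))
    (hgt : ∀ i j, i < j → g j (x i) = f (x i)) (n s : ℕ) (S : Sample)
    (hS : ∀ i, s ≤ i → i < s + 3 ^ n → Consistent (g i) S) : Shatters H n S := by
  induction n generalizing s S with
  | zero => exact ⟨g s, hg s, hS s le_rfl (by simp)⟩
  | succ n ih =>
    have hpow : 3 ^ (n + 1) = 3 * 3 ^ n := by ring
    have hpos : 0 < 3 ^ n := by positivity
    refine ⟨x (s + 3 ^ n), fun b => ?_⟩
    by_cases hb : f (x (s + 3 ^ n)) = b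
    · refine ih (s + 3 ^ n + 1) _ fun i hi hi' => ?_
      refine consistent_cons.2 ⟨?_, hS i (by omega) (by omega)⟩
      rw [hgt _ _ (by omega), hb]
    · refine ih s _ fun i hi hi' => ?_
      refine consistent_cons.2 ⟨?_, hS i (by omega) (by omega)⟩
      have := hlt i (s + 3 ^ n) (by omega)
      revert this hb
      cases f (x (s + 3 ^ n)) <;> cases g i (x (s + 3 ^ n)) <;> cases b <;> simp

/-- If a class shatters trees of depth `n` in every neighbourhood of `f`, but not trees of
arbitrary depth, then finitely many depth-`n` trees suffice for one of them to agree with `f`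
at any given point. -/
theorem exists_lists_agreeing {Z : Set (ℕ → Bool)} {f : ℕ → Bool} {n m : ℕ}
    (hZ : ∀ S, Consistent f S → Shatters Z n S) (hm : ¬ Shatters Z m []) :
    ∃ 𝒢 : List (List (ℕ → Bool)),
      (∀ G ∈ 𝒢, (∀ g ∈ G, g ∈ Z) ∧ Shatters {g | g ∈ G} n []) ∧
      ∀ x, ∃ G ∈ 𝒢, ∀ g ∈ G, g x = f x := by
  by_contra! hcon
  obtain ⟨u, hu, hur⟩ := exists_seq_of_forall_finset_exists
    (fun p : List (ℕ → Bool) × ℕ => (∀ g ∈ p.1, g ∈ Z) ∧ Shatters {g | g ∈ p.1} n [])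
    (fun p q => (∀ g ∈ q.1, g p.2 = f p.2) ∧ ∃ g ∈ p.1, g q.2 ≠ f q.2) (by
      intro s hs
      obtain ⟨G, hG, hGs⟩ := (hZ (s.toList.map fun p => (p.2, f p.2)) (by
        intro p hp
        obtain ⟨q, -, rfl⟩ := List.mem_map.1 hp
        rfl)).exists_list
      obtain ⟨x, hx⟩ := hcon (s.toList.map Prod.fst) (by
        intro G hG
        obtain ⟨p, hp, rfl⟩ := List.mem_map.1 hG
        exact hs p (Finset.mem_toList.1 hp))
      refine ⟨(G, x), ⟨fun g hg => (hG g hg).1, hGs.of_realizable ?_⟩, fun p hp => ⟨?_, ?_⟩⟩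
      · rintro R ⟨h, hh, hc⟩
        exact ⟨h, hh, by simpa using (consistent_append.1 hc).1⟩
      · intro g hg
        exact (hG g hg).2 (p.2, f p.2)
          (List.mem_map.2 ⟨p, Finset.mem_toList.2 hp, rfl⟩)
      · exact hx p.1 (List.mem_map.2 ⟨p, Finset.mem_toList.2 hp, rfl⟩))
  have hch : ∀ i, ∃ g ∈ (u i).1,
      ∀ᶠ j in (Filter.hyperfilter ℕ : Filter ℕ), g (u j).2 ≠ f (u j).2 := by
    intro i
    have hfin : {g | g ∈ (u i).1}.Finite := List.finite_toSet _
    refine (Ultrafilter.finite_biUnion_mem_iff (f := Filter.hyperfilter ℕ)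
      (s := fun g => {j | g (u j).2 ≠ f (u j).2}) hfin).1 ?_
    apply Filter.hyperfilter_le_cofinite
    rw [Nat.cofinite_eq_atTop]
    filter_upwards [Filter.eventually_gt_atTop i] with j hj
    obtain ⟨g, hg, hgj⟩ := (hur i j hj).2
    exact Set.mem_biUnion (show g ∈ {g | g ∈ (u i).1} from hg) hgj
  choose g hg hgU using hch
  obtain ⟨φ, -, hφ⟩ := exists_seq_of_forall_finset_exists (fun _ : ℕ => True)
    (fun i j => i < j ∧ g i (u j).2 ≠ f (u j).2) (by
      intro s _
      have h1 : ∀ᶠ j in (Filter.hyperfilter ℕ : Filter ℕ),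
          ∀ i ∈ s, i < j ∧ g i (u j).2 ≠ f (u j).2 := by
        rw [Filter.eventually_all_finset]
        intro i _
        refine Filter.Eventually.and ?_ (hgU i)
        apply Filter.hyperfilter_le_cofinite
        rw [Nat.cofinite_eq_atTop]
        exact Filter.eventually_gt_atTop i
      obtain ⟨j, hj⟩ := h1.exists
      exact ⟨j, trivial, hj⟩)
  exact hm (shatters_of_thresholds (f := f) (g := fun a => g (φ a)) (x := fun a => (u (φ a)).2)
    (fun a => (hu _).1 _ (hg _)) (fun a b hab => (hφ a b hab).2)
    (fun a b hab => (hur _ _ (hφ a b hab).1).1 _ (hg _)) m 0 [] fun _ _ _ => consistent_nil _)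

theorem computable_list_all {G : List (ℕ → Bool)} (hG : ∀ g ∈ G, Computable g) :
    Computable fun x => G.all fun g => g x := by
  induction G with
  | nil => exact Computable.const true
  | cons g G ih =>
    simp only [List.all_cons]
    exact Primrec.and.to_comp.comp (hG g (by simp)) (ih fun h hh => hG h (by simp [hh]))

theorem computable_list_any {G : List (ℕ → Bool)} (hG : ∀ g ∈ G, Computable g) :
    Computable fun x => G.any fun g => g x := by
  induction G with
  | nil => exact Computable.const false
  | cons g G ih =>
    simp only [List.any_cons]
    exact Primrec.or.to_comp.comp (hG g (by simp)) (ih fun h hh => hG h (by simp [hh]))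

/-- An effectively closed class of finite Littlestone dimension has only computable members. -/
theorem EffClosed.computable_of_not_shatters {X : Set (ℕ → Bool)} (hX : EffClosed X) {n : ℕ}
    (hn : ¬ Shatters X n []) : ∀ f ∈ X, Computable f := by
  induction n generalizing X with
  | zero => exact fun f hf => absurd ⟨f, hf, consistent_nil f⟩ hn
  | succ n ih =>
    intro f hf
    by_cases hdrop : ∃ S, Consistent f S ∧ ¬ Shatters X n S
    · obtain ⟨S, hS, hns⟩ := hdrop
      exact ih (hX.inter_cyl S) (fun h => hns h.of_inter_cyl) f ⟨hf, hS⟩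
    push Not at hdrop
    by_cases hiso : ∃ S, Consistent f S ∧ ∀ h ∈ X, Consistent h S → h = f
    · obtain ⟨S, hS, huniq⟩ := hiso
      exact (hX.inter_cyl S).computable_of_unique ⟨hf, hS⟩ fun h hh => huniq h hh.1 hh.2
    push Not at hiso
    have hother : ∀ x, ¬ Shatters X n [(x, !f x)] := by
      intro x hx
      refine hn ⟨x, fun b => ?_⟩
      by_cases hb : f x = b
      · exact hdrop _ (consistent_cons.2 ⟨hb, consistent_nil f⟩)
      · have : b = !f x := by
          revert hb
          cases b <;> cases f x <;> simp
        exact this ▸ hx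
    have hcomp : ∀ g ∈ X \ {f}, Computable g := by
      rintro g ⟨hgX, hgf⟩
      obtain ⟨x, hx⟩ := Function.ne_iff.1 hgf
      refine ih (hX.inter_cyl [(x, !f x)]) (fun h => hother x h.of_inter_cyl) g
        ⟨hgX, consistent_cons.2 ⟨?_, consistent_nil g⟩⟩
      revert hx
      cases g x <;> cases f x <;> simp
    have hdense : ∀ S, Realizable X S → Realizable (X \ {f}) S := by
      rintro S ⟨h, hh, hc⟩
      by_cases hf' : h = f
      · subst hf'
        obtain ⟨h', hh', hc', hne⟩ := hiso S hc
        exact ⟨h', ⟨hh', hne⟩, hc'⟩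
      · exact ⟨h, ⟨hh, hf'⟩, hc⟩
    obtain ⟨𝒢, h𝒢, hagree⟩ := exists_lists_agreeing (Z := X \ {f}) (f := f) (n := n) (m := n + 1)
      (fun S hS => (hdrop S hS).of_realizable fun R => hdense _)
      (fun h => hn (h.mono Set.sdiff_subset))
    have hfx : ∀ x, ((𝒢.map fun G x => G.all fun g => g x).any fun a => a x) = f x := by
      intro x
      rw [Bool.eq_iff_iff]
      simp only [List.any_map, List.any_eq_true, Function.comp_apply, List.all_eq_true]
      constructor
      · rintro ⟨G, hG, hall⟩
        by_contra hfalse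
        refine hother x ((h𝒢 G hG).2.of_realizable ?_)
        rintro R ⟨g, hg, hc⟩
        refine ⟨g, ((h𝒢 G hG).1 g hg).1, consistent_append.2 ⟨(consistent_append.1 hc).1,
          consistent_cons.2 ⟨?_, consistent_nil g⟩⟩⟩
        rw [hall g hg]
        simpa using hfalse
      · intro htrue
        obtain ⟨G, hG, hall⟩ := hagree x
        exact ⟨G, hG, fun g hg => (hall g hg).trans htrue⟩
    refine (computable_list_any ?_).of_eq hfx
    intro a ha
    obtain ⟨G, hG, rfl⟩ := List.mem_map.1 ha
    exact computable_list_all fun g hg => hcomp g ((h𝒢 G hG).1 g hg)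

/-! ### Tree codes -/

theorem primrec_branchSample : Primrec₂ branchSample := by
  have hlookup : Primrec₂ fun (T : TreeCode) (p : List Bool) => T.lookup p := by
    convert (Primrec.listLookup (α := List Bool) (β := ℕ)).swap
  have hlabel : Primrec₂ nodeLabel := Primrec.option_getD.comp hlookup (Primrec.const 0)
  refine Primrec.list_map (Primrec.list_range.comp (Primrec.list_length.comp Primrec.snd)) ?_
  exact Primrec.pair
    (hlabel.comp (Primrec.fst.comp Primrec.fst)
      (Primrec.list_take.comp Primrec.snd (Primrec.snd.comp Primrec.fst)))
    ((Primrec.list_getD false).comp (Primrec.snd.comp Primrec.fst) Primrec.snd)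

/-- The code of the tree with root label `x` and the given subtrees. -/
def joinTrees (x : ℕ) (T : Bool → TreeCode) : TreeCode :=
  ([], x) :: (((T false).map fun e => (false :: e.1, e.2)) ++
    (T true).map fun e => (true :: e.1, e.2))

theorem lookup_map_cons_self (b : Bool) (p : List Bool) (T : TreeCode) :
    (T.map fun e => (b :: e.1, e.2)).lookup (b :: p) = T.lookup p := by
  induction T with
  | nil => rfl
  | cons e T ih =>
    obtain ⟨q, y⟩ := e
    by_cases h : p = q
    · simp [h]
    · have h1 : (p == q) = false := by simpa using h
      have h2 : (b :: p == b :: q) = false := by simpa using h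
      simp only [List.map_cons, List.lookup_cons, h1, h2]
      exact ih

theorem lookup_map_cons_ne {b c : Bool} (hbc : b ≠ c) (p : List Bool) (T : TreeCode) :
    (T.map fun e => (c :: e.1, e.2)).lookup (b :: p) = none := by
  induction T with
  | nil => rfl
  | cons e T ih =>
    have h2 : (b :: p == c :: e.1) = false := by simp [hbc]
    simp only [List.map_cons, List.lookup_cons, h2]
    exact ih

theorem nodeLabel_joinTrees_cons (x : ℕ) (T : Bool → TreeCode) (b : Bool) (p : List Bool) :
    nodeLabel (joinTrees x T) (b :: p) = nodeLabel (T b) p := by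
  have h : (b :: p == []) = false := by simp
  unfold nodeLabel joinTrees
  rw [List.lookup_cons, h, List.lookup_append]
  cases b
  · rw [lookup_map_cons_self, lookup_map_cons_ne (by simp)]
    simp
  · rw [lookup_map_cons_self, lookup_map_cons_ne (by simp)]
    simp

theorem branchSample_joinTrees_cons (x : ℕ) (T : Bool → TreeCode) (b : Bool) (p : List Bool) :
    branchSample (joinTrees x T) (b :: p) = (x, b) :: branchSample (T b) p := by
  simp only [branchSample, List.length_cons, List.range_succ_eq_map, List.map_cons, List.map_map]
  congr 1
  refine List.map_congr_left fun i _ => ?_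
  simp [nodeLabel_joinTrees_cons]

theorem Shatters.exists_treeCode {H : Set (ℕ → Bool)} {n : ℕ} {S : Sample}
    (h : Shatters H n S) :
    ∃ T : TreeCode, ∀ p : List Bool, p.length = n → Realizable H (branchSample T p ++ S) := by
  induction n generalizing S with
  | zero =>
    refine ⟨[], fun p hp => ?_⟩
    rw [List.length_eq_zero_iff.1 hp]
    exact h
  | succ n ih =>
    obtain ⟨x, hx⟩ := h
    choose T hT using fun b => ih (hx b)
    refine ⟨joinTrees x T, fun p hp => ?_⟩
    cases p with
    | nil => simp at hp
    | cons b p =>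
      obtain ⟨f, hf, hc⟩ := hT b p (by simpa using hp)
      refine ⟨f, hf, ?_⟩
      simp only [branchSample_joinTrees_cons, List.cons_append, consistent_cons,
        consistent_append] at hc ⊢
      tauto

/-- A class of finite effective Littlestone dimension extends to an effectively closed class of
finite Littlestone dimension. -/
theorem EldimLe.exists_effClosed {H : Set (ℕ → Bool)} {d : ℕ} (h : EldimLe H d) :
    ∃ X, H ⊆ X ∧ EffClosed X ∧ ¬ Shatters X (d + 1) [] := by
  obtain ⟨A, hA, hAT⟩ := h
  refine ⟨{f | ∀ T, ¬ Consistent f (branchSample T (A T))}, fun f hf T hc => (hAT T).2 ⟨f, hf, hc⟩,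
    ⟨fun n => branchSample (((Encodable.decode n : Option TreeCode)).getD [])
      (A ((Encodable.decode n : Option TreeCode).getD [])), ?_, ?_⟩, fun hs => ?_⟩
  · have hd : Computable fun n => (Encodable.decode n : Option TreeCode).getD [] :=
      (Primrec.option_getD.comp Primrec.decode (Primrec.const [])).to_comp
    exact primrec_branchSample.to_comp.comp hd (hA.comp hd)
  · ext f
    simp only [Set.mem_compl_iff, Set.mem_ofPred_eq, not_forall, not_not, Set.mem_iUnion, Cyl]
    constructor
    · rintro ⟨T, hT⟩
      exact ⟨Encodable.encode T, by simpa using hT⟩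
    · rintro ⟨n, hn⟩
      exact ⟨_, hn⟩
  · obtain ⟨T, hT⟩ := hs.exists_treeCode
    obtain ⟨f, hf, hc⟩ := hT (A T) (hAT T).1
    exact hf T (by simpa using hc)

theorem stmt12 (H : Set (ℕ → Bool)) (h : Eldim H ≠ ⊤) : ∀ f ∈ H, Computable f := by
  obtain ⟨d, hd⟩ : ∃ d, EldimLe H d := by
    by_contra! hcon
    have hempty : {d : ℕ | EldimLe H d} = ∅ := Set.eq_empty_iff_forall_notMem.2 hcon
    exact h (by simp [Eldim, hempty])
  obtain ⟨X, hHX, hX, hns⟩ := hd.exists_effClosed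
  exact fun f hf => hX.computable_of_not_shatters hns f (hHX hf)
end

section
/- A hypothesis class H has effective Littlestone dimension at most d if and only if there exists a total computable learner with an upper bound that online learns H in the bounded regime with at most d mistakes. -/
/-! ### Computability of the basic operations -/

theorem primrec_nodeLabel : Primrec₂ nodeLabel := by
  have hidx : Primrec₂ fun (T : TreeCode) (p : List Bool) => T.findIdx fun e => decide (p = e.1) :=
    Primrec.list_findIdx Primrec.fst
      (Primrec.eq.comp (Primrec.snd.comp Primrec.fst) (Primrec.fst.comp Primrec.snd)).decide.to₂
  have hget : Primrec₂ fun (T : TreeCode) (p : List Bool) =>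
      (T[T.findIdx fun e => decide (p = e.1)]?.map Prod.snd).getD 0 :=
    Primrec.option_getD.comp
      (Primrec.option_map (Primrec.list_getElem?.comp Primrec.fst hidx)
        (Primrec.snd.comp Primrec.snd).to₂)
      (Primrec.const 0)
  refine hget.of_eq fun T p => ?_
  unfold nodeLabel
  congr 1
  induction T with
  | nil => simp
  | cons e T ih =>
    obtain ⟨q, n⟩ := e
    rw [List.findIdx_cons, List.lookup_cons]
    by_cases h : p = q <;> simp [h, ih, beq_eq_false_iff_ne.2]

theorem primrec_sample_subset : Primrec₂ fun S S' : Sample => decide (S ⊆ S') := by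
  have hmem : PrimrecRel fun (p : ℕ × Bool) (S : Sample) => ∃ q ∈ S, q = p :=
    (PrimrecRel.exists_mem_list Primrec.eq).comp Primrec.snd Primrec.fst
  have hsub := hmem.forall_mem_list
  exact (PrimrecRel.of_eq hsub fun S S' => by simp [List.subset_def]).decide

/-- Boolean-valued bounded existential quantifier. -/
def existsBelow (n : ℕ) (f : ℕ → Bool) : Bool :=
  Nat.rec (motive := fun _ => Bool) false (fun i acc => acc || f i) n

theorem existsBelow_eq_true {n : ℕ} {f : ℕ → Bool} :
    existsBelow n f = true ↔ ∃ i < n, f i = true := by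
  induction n with
  | zero => simp [existsBelow]
  | succ n ih =>
    have : existsBelow (n + 1) f = (existsBelow n f || f n) := rfl
    rw [this, Bool.or_eq_true, ih]
    simp only [Nat.lt_succ_iff_lt_or_eq, or_and_right, exists_or, exists_eq_left]

theorem Computable.existsBelow {α : Type*} [Primcodable α] {n : α → ℕ} {f : α → ℕ → Bool}
    (hn : Computable n) (hf : Computable₂ f) :
    Computable fun a => existsBelow (n a) (f a) := by
  have hstep : Computable₂ fun (a : α) (q : ℕ × Bool) => q.2 || f a q.1 :=
    Primrec.or.to_comp.comp (Computable.snd.comp Computable.snd)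
      (hf.comp Computable.fst (Computable.fst.comp Computable.snd))
  exact Computable.nat_rec hn (Computable.const false) hstep

/-! ### Basic facts on samples, trees and mistakes -/

theorem branchSample_append (T : TreeCode) (p : List Bool) (b : Bool) :
    branchSample T (p ++ [b]) = branchSample T p ++ [(nodeLabel T p, b)] := by
  unfold branchSample
  rw [List.length_append, List.length_singleton, List.range_succ, List.map_append]
  congr 1
  · refine List.map_congr_left fun i hi => ?_
    have hi : i < p.length := List.mem_range.1 hi
    rw [List.take_append_of_le_length hi.le, List.getD_append _ _ _ _ hi]
  · simp

theorem nodeLabel_of_forall_mem {T : TreeCode} {g : List Bool → ℕ} (hT : ∀ e ∈ T, e.2 = g e.1)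
    {p : List Bool} (hp : ∃ e ∈ T, e.1 = p) : nodeLabel T p = g p := by
  unfold nodeLabel
  induction T with
  | nil => simp at hp
  | cons e T ih =>
    obtain ⟨q, n⟩ := e
    rw [List.lookup_cons]
    cases h : p == q with
    | true =>
      have h : p = q := by simpa using h
      subst h
      simpa using hT (p, n) (by simp)
    | false =>
      have h : p ≠ q := by simpa using h
      refine ih (fun e he => hT e (List.mem_cons_of_mem _ he)) ?_
      obtain ⟨e, he, rfl⟩ := hp
      rcases List.mem_cons.1 he with rfl | he
      · exact absurd rfl h
      · exact ⟨e, he, rfl⟩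

theorem mistakes_append (L : Learner) (S : Sample) (x : ℕ) (y : Bool) :
    mistakes L (S ++ [(x, y)]) = mistakes L S + if L S x ≠ y then 1 else 0 := by
  unfold mistakes
  rw [List.length_append, List.length_singleton, List.range_succ, List.countP_append]
  congr 1
  · refine List.countP_congr fun i hi => ?_
    have hi : i < S.length := List.mem_range.1 hi
    rw [List.take_append_of_le_length hi.le, List.getD_append _ _ _ _ hi]
  · simp

theorem Realizable.of_subset {H : Set (ℕ → Bool)} {S S' : Sample} (h : Realizable H S')
    (hS : S ⊆ S') : Realizable H S :=
  let ⟨f, hf, hc⟩ := h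
  ⟨f, hf, fun p hp => hc p (hS hp)⟩

theorem Eldim_le_iff {H : Set (ℕ → Bool)} {d : ℕ} :
    Eldim H ≤ (d : ℕ∞) ↔ ∃ d' ≤ d, EldimLe H d' := by
  constructor
  · intro h
    have hne : (((↑) : ℕ → ℕ∞) '' {d : ℕ | EldimLe H d}).Nonempty := by
      by_contra hemp
      rw [Set.not_nonempty_iff_eq_empty] at hemp
      rw [Eldim, hemp, sInf_empty] at h
      exact absurd h (by simp)
    obtain ⟨d', hd', he⟩ := csInf_mem hne
    refine ⟨d', ?_, hd'⟩
    rw [Eldim, ← he] at h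
    exact_mod_cast h
  · rintro ⟨d', hd, h⟩
    exact (sInf_le (Set.mem_image_of_mem ((↑) : ℕ → ℕ∞) h)).trans (Nat.cast_le.2 hd)

/-! ### From a learner to the effective Littlestone dimension -/

/-- An upper bound for the labels of the nodes of a coded tree. -/
def labelBound (T : TreeCode) : ℕ := T.foldr (fun e m => e.2 + m) 0

theorem primrec_labelBound : Primrec labelBound :=
  Primrec.list_foldr Primrec.id (Primrec.const 0)
    (Primrec.nat_add.comp (Primrec.snd.comp (Primrec.fst.comp Primrec.snd))
      (Primrec.snd.comp Primrec.snd)).to₂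

theorem nodeLabel_le_labelBound (T : TreeCode) (p : List Bool) :
    nodeLabel T p ≤ labelBound T := by
  unfold nodeLabel
  induction T with
  | nil => simp
  | cons e T ih =>
    obtain ⟨q, n⟩ := e
    have hb : labelBound ((q, n) :: T) = n + labelBound T := rfl
    rw [List.lookup_cons, hb]
    cases p == q
    · exact ih.trans (Nat.le_add_left _ _)
    · simp

/-- The branch of length `k` of `T` along which the learner errs at every node. -/
def adversarialBranch (L : ℕ → Learner) (T : TreeCode) : ℕ → List Bool
  | 0 => []
  | k + 1 =>
    let p := adversarialBranch L T k
    p ++ [!L (labelBound T) (branchSample T p) (nodeLabel T p)]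

theorem length_adversarialBranch (L : ℕ → Learner) (T : TreeCode) (k : ℕ) :
    (adversarialBranch L T k).length = k := by
  induction k with
  | zero => rfl
  | succ k ih => simp [adversarialBranch, ih]

theorem computable_adversarialBranch {L : ℕ → Learner}
    (hL : Computable fun q : ℕ × Sample × ℕ => L q.1 q.2.1 q.2.2) (k : ℕ) :
    Computable fun T => adversarialBranch L T k := by
  induction k with
  | zero => exact Computable.const []
  | succ k ih =>
    refine Computable.list_concat.comp ih (Primrec.not.to_comp.comp ?_)
    exact hL.comp (primrec_labelBound.to_comp.pair
      ((primrec_branchSample.to_comp.comp Computable.id ih).pair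
        (primrec_nodeLabel.to_comp.comp Computable.id ih)))

theorem mistakes_adversarialBranch (L : ℕ → Learner) (T : TreeCode) (k : ℕ) :
    mistakes (L (labelBound T)) (branchSample T (adversarialBranch L T k)) = k := by
  induction k with
  | zero => rfl
  | succ k ih => simp [adversarialBranch, branchSample_append, mistakes_append, ih]

theorem EldimLe.of_learner {H : Set (ℕ → Bool)} {d : ℕ} {L : ℕ → Learner}
    (hL : Computable fun q : ℕ × Sample × ℕ => L q.1 q.2.1 q.2.2)
    (hd : ∀ N : ℕ, ∀ S : Sample, Realizable H S → (∀ p ∈ S, p.1 ≤ N) → mistakes (L N) S ≤ d) :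
    EldimLe H d := by
  refine ⟨fun T => adversarialBranch L T (d + 1), computable_adversarialBranch hL _, fun T =>
    ⟨length_adversarialBranch _ _ _, fun hr => ?_⟩⟩
  have h := hd (labelBound T) _ hr fun p hp => by
    obtain ⟨i, -, rfl⟩ := List.mem_map.1 hp
    exact nodeLabel_le_labelBound _ _
  rw [mistakes_adversarialBranch] at h
  omega

/-! ### The standard optimal algorithm relative to a base predicate on samples -/

/-- `survives B N k S`: some tree of depth `k` with labels at most `N` can be put below the sample
`S` so that every leaf satisfies `B`. -/
def survives (B : ℕ → Sample → Bool) (N : ℕ) : ℕ → Sample → Bool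
  | 0, S => B N S
  | k + 1, S => existsBelow (N + 1) fun x =>
      survives B N k (S ++ [(x, false)]) && survives B N k (S ++ [(x, true)])

/-- One more than the largest `k < n` such that `survives B N k S`, and `0` if there is none. -/
def survivalRank (B : ℕ → Sample → Bool) : ℕ → ℕ → Sample → ℕ
  | 0, _, _ => 0
  | n + 1, N, S => bif survives B N n S then n + 1 else survivalRank B n N S

/-- The learner predicting the label which leaves the larger rank. -/
def optimalLearner (B : ℕ → Sample → Bool) (n N : ℕ) : Learner := fun S x =>
  decide (survivalRank B n N (S ++ [(x, false)]) ≤ survivalRank B n N (S ++ [(x, true)]))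

section Computability

variable {B : ℕ → Sample → Bool}

theorem computable_survives (hB : Computable₂ B) (k : ℕ) :
    Computable₂ fun N S => survives B N k S := by
  induction k with
  | zero => exact hB
  | succ k ih =>
    have hext (b : Bool) : Computable fun a : (ℕ × Sample) × ℕ =>
        survives B a.1.1 k (a.1.2 ++ [(a.2, b)]) :=
      ih.comp (Computable.fst.comp Computable.fst)
        (Computable.list_concat.comp (Computable.snd.comp Computable.fst)
          (Computable.snd.pair (Computable.const b)))
    exact Computable.existsBelow (Computable.succ.comp Computable.fst)
      (Primrec.and.to_comp.comp (hext false) (hext true))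

theorem computable_survivalRank (hB : Computable₂ B) (n : ℕ) :
    Computable₂ fun N S => survivalRank B n N S := by
  induction n with
  | zero => exact Computable.const 0
  | succ n ih => exact Computable.cond (computable_survives hB n) (Computable.const (n + 1)) ih

theorem computable_optimalLearner (hB : Computable₂ B) (d : ℕ) :
    Computable fun q : ℕ × Sample × ℕ => optimalLearner B d q.1 q.2.1 q.2.2 := by
  have hext (b : Bool) : Computable fun q : ℕ × Sample × ℕ =>
      survivalRank B d q.1 (q.2.1 ++ [(q.2.2, b)]) :=
    (computable_survivalRank hB d).comp Computable.fst
      (Computable.list_concat.comp (Computable.fst.comp Computable.snd)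
        ((Computable.snd.comp Computable.snd).pair (Computable.const b)))
  exact Primrec.nat_le.decide.to_comp.comp (hext false) (hext true)

end Computability

section Optimality

variable {B : ℕ → Sample → Bool} {N : ℕ}

theorem survives_succ {k : ℕ} {S : Sample} :
    survives B N (k + 1) S = true ↔ ∃ x ≤ N, ∀ b, survives B N k (S ++ [(x, b)]) = true := by
  simp [survives, existsBelow_eq_true]

theorem survives_of_subset (hB : ∀ S S', S ⊆ S' → B N S' = true → B N S = true) {k : ℕ} :
    ∀ {S S' : Sample}, S ⊆ S' → survives B N k S' = true → survives B N k S = true := by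
  induction k with
  | zero => exact fun hS h => hB _ _ hS h
  | succ k ih =>
    intro S S' hS h
    obtain ⟨x, hx, h⟩ := survives_succ.1 h
    exact survives_succ.2 ⟨x, hx, fun b => ih (List.append_subset.2
      ⟨fun p hp => List.mem_append_left _ (hS hp), List.subset_append_right _ _⟩) (h b)⟩

theorem survives_of_le (hB : ∀ S S', S ⊆ S' → B N S' = true → B N S = true) {S : Sample}
    {j k : ℕ} (hjk : j ≤ k) (h : survives B N k S = true) : survives B N j S = true := by
  induction k, hjk using Nat.le_induction with
  | base => exact h
  | succ k _ ih =>
    obtain ⟨x, -, hx⟩ := survives_succ.1 h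
    exact ih (survives_of_subset hB (List.subset_append_left _ _) (hx false))

theorem lt_survivalRank_iff (hB : ∀ S S', S ⊆ S' → B N S' = true → B N S = true) {k n : ℕ}
    {S : Sample} : k < survivalRank B n N S ↔ k < n ∧ survives B N k S = true := by
  induction n with
  | zero => simp [survivalRank]
  | succ n ih =>
    rw [survivalRank]
    cases h : survives B N n S with
    | true =>
      rw [cond_true]
      exact ⟨fun hk => ⟨hk, survives_of_le hB (Nat.lt_succ_iff.1 hk) h⟩, And.left⟩
    | false =>
      rw [cond_false, ih]
      refine ⟨fun hk => ⟨hk.1.trans n.lt_succ_self, hk.2⟩, fun hk => ⟨?_, hk.2⟩⟩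
      refine lt_of_le_of_ne (Nat.lt_succ_iff.1 hk.1) ?_
      rintro rfl
      simp [h] at hk

theorem survivalRank_le_of_subset (hB : ∀ S S', S ⊆ S' → B N S' = true → B N S = true) {n : ℕ}
    {S S' : Sample} (hS : S ⊆ S') : survivalRank B n N S' ≤ survivalRank B n N S := by
  refine le_of_forall_lt fun k hk => ?_
  rw [lt_survivalRank_iff hB] at hk ⊢
  exact ⟨hk.1, survives_of_subset hB hS hk.2⟩

theorem survivalRank_le (n : ℕ) (S : Sample) : survivalRank B n N S ≤ n := by
  induction n with
  | zero => rfl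
  | succ n ih =>
    rw [survivalRank]
    cases survives B N n S
    · exact ih.trans n.le_succ
    · rfl

theorem survivalRank_lt_of_mistake (hB : ∀ S S', S ⊆ S' → B N S' = true → B N S = true) {d : ℕ}
    (hd : survives B N (d + 1) [] = false) {S : Sample} {x : ℕ} {y : Bool} (hx : x ≤ N)
    (h : B N (S ++ [(x, y)]) = true) (hy : optimalLearner B (d + 1) N S x ≠ y) :
    survivalRank B (d + 1) N (S ++ [(x, y)]) < survivalRank B (d + 1) N S := by
  have hle : survivalRank B (d + 1) N (S ++ [(x, y)]) ≤
      survivalRank B (d + 1) N (S ++ [(x, !y)]) := by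
    cases y
    · simpa [optimalLearner] using hy
    · simp only [optimalLearner, ne_eq, decide_eq_true_eq, not_le] at hy
      exact hy.le
  have hpos : 0 < survivalRank B (d + 1) N (S ++ [(x, y)]) :=
    (lt_survivalRank_iff hB).2 ⟨d.succ_pos, h⟩
  obtain ⟨k, hk⟩ := Nat.exists_eq_succ_of_ne_zero hpos.ne'
  have hky := (lt_survivalRank_iff hB).1 (hk ▸ k.lt_succ_self)
  have hkn := (lt_survivalRank_iff hB).1 ((hk ▸ k.lt_succ_self).trans_le hle)
  have hsucc : survives B N (k + 1) S = true := survives_succ.2 ⟨x, hx, fun b => by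
    rcases Bool.eq_or_eq_not b y with rfl | rfl
    · exact hky.2
    · exact hkn.2⟩
  rw [hk]
  refine (lt_survivalRank_iff hB).2 ⟨lt_of_le_of_ne hky.1 fun heq => ?_, hsucc⟩
  have heq : k = d := by simpa using heq
  subst heq
  rw [survives_of_subset hB (List.nil_subset S) hsucc] at hd
  exact absurd hd (by simp)

theorem mistakes_optimalLearner_le (hB : ∀ S S', S ⊆ S' → B N S' = true → B N S = true) {d : ℕ}
    (hd : survives B N (d + 1) [] = false) {S : Sample} (hN : ∀ p ∈ S, p.1 ≤ N)
    (h : B N S = true) : mistakes (optimalLearner B (d + 1) N) S ≤ d := by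
  have key : mistakes (optimalLearner B (d + 1) N) S + survivalRank B (d + 1) N S ≤ d + 1 := by
    induction S using List.reverseRecOn with
    | nil =>
      have hm : mistakes (optimalLearner B (d + 1) N) [] = 0 := rfl
      rw [hm, Nat.zero_add]
      exact survivalRank_le _ _
    | append_singleton S p ih =>
      obtain ⟨x, y⟩ := p
      have hsub : S ⊆ S ++ [(x, y)] := List.subset_append_left _ _
      have ih := ih (fun p hp => hN p (hsub hp)) (hB _ _ hsub h)
      rw [mistakes_append]
      split_ifs with hy
      · have hx : x ≤ N := hN (x, y) (by simp)
        have := survivalRank_lt_of_mistake hB hd hx h hy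
        omega
      · have := survivalRank_le_of_subset (n := d + 1) hB hsub
        omega
  have hpos : 0 < survivalRank B (d + 1) N S := (lt_survivalRank_iff hB).2 ⟨d.succ_pos, h⟩
  omega

theorem exists_labels_of_survives {k : ℕ} : ∀ {S : Sample}, survives B N k S = true →
    ∃ g : List Bool → ℕ, (∀ p, g p ≤ N) ∧ ∀ p : List Bool, p.length = k →
      B N (S ++ (List.range p.length).map fun i => (g (p.take i), p.getD i false)) = true := by
  induction k with
  | zero =>
    intro S h
    refine ⟨fun _ => 0, fun _ => Nat.zero_le _, fun p hp => ?_⟩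
    rw [List.length_eq_zero_iff.1 hp]
    simpa [survives] using h
  | succ k ih =>
    intro S h
    obtain ⟨x, hx, h⟩ := survives_succ.1 h
    choose g hgN hg using fun b => ih (h b)
    refine ⟨fun p => p.casesOn x g, fun p => ?_, fun p hp => ?_⟩
    · cases p with
      | nil => exact hx
      | cons b p => exact hgN b p
    · cases p with
      | nil => simp at hp
      | cons b p =>
        have := hg b p (by simpa using hp)
        rw [List.append_assoc] at this
        rw [List.length_cons, List.range_succ_eq_map, List.map_cons, List.map_map]
        exact this

end Optimality

/-! ### From the effective Littlestone dimension to a learner -/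

/-- `allows A P N T S`: no extension of the coded tree `T` by labels at most `N` for the nodes in
`P` has its branch chosen by `A` contained in the sample `S`. -/
def allows (A : TreeCode → List Bool) : List (List Bool) → ℕ → TreeCode → Sample → Bool
  | [], _, T, S => !decide (branchSample T (A T) ⊆ S)
  | p :: P, N, T, S => !existsBelow (N + 1) fun x => !allows A P N ((p, x) :: T) S

section Allows

variable {A : TreeCode → List Bool}

theorem computable_allows (hA : Computable A) (P : List (List Bool)) :
    Computable fun q : ℕ × TreeCode × Sample => allows A P q.1 q.2.1 q.2.2 := by
  induction P with
  | nil =>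
    have hT : Computable fun q : ℕ × TreeCode × Sample => q.2.1 :=
      Computable.fst.comp Computable.snd
    exact Primrec.not.to_comp.comp (primrec_sample_subset.to_comp.comp
      (primrec_branchSample.to_comp.comp hT (hA.comp hT)) (Computable.snd.comp Computable.snd))
  | cons p P ih =>
    have hq : Computable fun a : (ℕ × TreeCode × Sample) × ℕ => a.1.2 :=
      Computable.snd.comp Computable.fst
    have hcons : Computable fun a : (ℕ × TreeCode × Sample) × ℕ => (p, a.2) :: a.1.2.1 :=
      Computable.list_cons.comp ((Computable.const p).pair Computable.snd)
        (Computable.fst.comp hq)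
    exact Primrec.not.to_comp.comp
      (Computable.existsBelow (Computable.succ.comp Computable.fst)
        (Primrec.not.to_comp.comp
          (ih.comp ((Computable.fst.comp Computable.fst).pair
            (hcons.pair (Computable.snd.comp hq))))))

theorem allows_of_forall {P : List (List Bool)} {N : ℕ} {S : Sample}
    (h : ∀ T, ¬ branchSample T (A T) ⊆ S) (T : TreeCode) : allows A P N T S = true := by
  induction P generalizing T with
  | nil => simpa [allows] using h T
  | cons p P ih => simp [allows, ih, existsBelow_eq_true, Bool.eq_false_iff]

theorem exists_tree_of_allows {P : List (List Bool)} {N : ℕ} {g : List Bool → ℕ}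
    (hg : ∀ p, g p ≤ N) (T : TreeCode) (hT : ∀ e ∈ T, e.2 = g e.1) :
    ∃ T' : TreeCode, T ⊆ T' ∧ (∀ e ∈ T', e.2 = g e.1) ∧ (∀ p ∈ P, ∃ e ∈ T', e.1 = p) ∧
      ∀ S, allows A P N T S = true → ¬ branchSample T' (A T') ⊆ S := by
  induction P generalizing T with
  | nil => exact ⟨T, List.Subset.refl T, hT, by simp, fun S h => by simpa [allows] using h⟩
  | cons p P ih =>
    obtain ⟨T', hsub, hT', hP, hS⟩ := ih ((p, g p) :: T) (by simpa using hT)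
    refine ⟨T', fun e he => hsub (List.mem_cons_of_mem _ he), hT', ?_, fun S h => hS S ?_⟩
    · rintro q hq
      rcases List.mem_cons.1 hq with rfl | hq
      · exact ⟨_, hsub List.mem_cons_self, rfl⟩
      · exact hP q hq
    · by_contra hn
      have : existsBelow (N + 1) (fun x => !allows A P N ((p, x) :: T) S) = true :=
        existsBelow_eq_true.2 ⟨g p, Nat.lt_succ_iff.2 (hg p), by simpa using hn⟩
      simp [allows, this] at h

theorem allows_of_subset {P : List (List Bool)} {N : ℕ} {T : TreeCode} {S S' : Sample}
    (hS : S ⊆ S') (h : allows A P N T S' = true) : allows A P N T S = true := by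
  induction P generalizing T with
  | nil =>
    simp only [allows, Bool.not_eq_true', decide_eq_false_iff_not] at h ⊢
    exact fun h' => h (List.Subset.trans h' hS)
  | cons p P ih =>
    simp only [allows, Bool.not_eq_true', Bool.eq_false_iff, ne_eq, existsBelow_eq_true,
      not_exists, not_and, Bool.not_eq_true'] at h ⊢
    exact fun x hx => by simpa using ih (by simpa using h x hx)

theorem survives_allows_eq_false {P : List (List Bool)} {N d : ℕ}
    (hA : ∀ T, (A T).length = d + 1) (hP : ∀ p : List Bool, p.length ≤ d → p ∈ P) :
    survives (fun N => allows A P N []) N (d + 1) [] = false := by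
  by_contra h
  obtain ⟨g, hgN, hg⟩ := exists_labels_of_survives (by simpa using h)
  obtain ⟨T, -, hT, hTP, hTS⟩ := exists_tree_of_allows (A := A) (P := P) hgN [] (by simp)
  refine hTS _ (hg (A T) (hA T)) ?_
  rw [List.nil_append, branchSample, List.map_congr_left]
  · exact List.Subset.refl _
  · intro i hi
    have hi : i < (A T).length := List.mem_range.1 hi
    rw [hA] at hi
    rw [nodeLabel_of_forall_mem hT (hTP _ (hP _ ?_))]
    exact (List.length_take_le _ _).trans (Nat.lt_succ_iff.1 hi)

end Allows

theorem EldimLe.exists_learner {H : Set (ℕ → Bool)} {d : ℕ} (h : EldimLe H d) :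
    ∃ L : ℕ → Learner, Computable (fun q : ℕ × Sample × ℕ => L q.1 q.2.1 q.2.2) ∧
      ∀ N : ℕ, ∀ S : Sample, Realizable H S → (∀ p ∈ S, p.1 ≤ N) → mistakes (L N) S ≤ d := by
  obtain ⟨A, hA, hAT⟩ := h
  obtain ⟨P, hP⟩ : ∃ P : List (List Bool), ∀ p : List Bool, p.length ≤ d → p ∈ P :=
    ⟨(List.finite_length_le Bool d).toFinset.toList, fun p hp => by simpa using hp⟩
  have hB : Computable₂ fun N => allows A P N [] :=
    (computable_allows hA P).comp
      (Computable.fst.pair ((Computable.const []).pair Computable.snd))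
  refine ⟨_, computable_optimalLearner hB (d + 1), fun N S hS hN => ?_⟩
  refine mistakes_optimalLearner_le (fun _ _ => allows_of_subset)
    (survives_allows_eq_false (fun T => (hAT T).1) hP) hN (allows_of_forall (fun T hT => ?_) [])
  exact (hAT T).2 (hS.of_subset hT)

theorem stmt14 (H : Set (ℕ → Bool)) (d : ℕ) :
    Eldim H ≤ (d : ℕ∞) ↔
      ∃ L : ℕ → Sample → ℕ → Bool,
        Computable (fun q : ℕ × Sample × ℕ => L q.1 q.2.1 q.2.2) ∧
        ∀ N : ℕ, ∀ S : Sample, Realizable H S → (∀ p ∈ S, p.1 ≤ N) →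
          mistakes (L N) S ≤ d := by
  rw [Eldim_le_iff]
  constructor
  · rintro ⟨d', hd, h⟩
    obtain ⟨L, hL, hm⟩ := h.exists_learner
    exact ⟨L, hL, fun N S hS hN => (hm N S hS hN).trans hd⟩
  · rintro ⟨L, hL, hm⟩
    exact ⟨d, le_rfl, EldimLe.of_learner hL hm⟩
end

section
/- Every hypothesis class H of effective Littlestone dimension at most 1 admits a total computable online learner making at most 1 mistake on every H-realizable sample. -/
/-! ### Isolated points of effectively closed sets are computable -/

/-- The list of all bit strings of length `n`. -/
def bitStrings (n : ℕ) : List (List Bool) :=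
  Nat.rec [[]] (fun _ L => L.flatMap fun σ => [false :: σ, true :: σ]) n

theorem mem_bitStrings {n : ℕ} {σ : List Bool} : σ ∈ bitStrings n ↔ σ.length = n := by
  induction n generalizing σ with
  | zero => simp [bitStrings]
  | succ n ih =>
    change σ ∈ (bitStrings n).flatMap (fun σ => [false :: σ, true :: σ]) ↔ _
    simp only [List.mem_flatMap, ih]
    constructor
    · rintro ⟨τ, rfl, h⟩
      simp only [List.mem_cons, List.not_mem_nil, or_false] at h
      rcases h with rfl | rfl <;> simp
    · intro h
      match σ, h with
      | b :: τ, h =>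
        refine ⟨τ, by simpa using h, ?_⟩
        cases b <;> simp

theorem primrec_bitStrings : Primrec bitStrings := by
  refine Primrec.nat_rec₁ [[]] ?_
  change Primrec fun p : ℕ × List (List Bool) => p.2.flatMap fun σ => [false :: σ, true :: σ]
  refine Primrec.list_flatMap Primrec.snd ?_
  change Primrec fun p : (ℕ × List (List Bool)) × List Bool => [false :: p.2, true :: p.2]
  exact Primrec.list_cons.comp (Primrec.list_cons.comp (.const false) .snd)
    (Primrec.list_cons.comp (Primrec.list_cons.comp (.const true) .snd) (.const []))

/-- The first `n` terms of a computable sequence can be computed uniformly in `n`. -/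
theorem computable_map_range {α : Type*} [Primcodable α] {g : ℕ → α} (hg : Computable g) :
    Computable fun n => (List.range n).map g := by
  have h : Computable fun n : ℕ =>
      (Nat.rec [] (fun i L => L ++ [g i]) n : List α) :=
    Computable.nat_rec (h := fun _ p => p.2 ++ [g p.1]) Computable.id (.const [])
      (Computable.to₂ (Computable.list_concat.comp (Computable.snd.comp .snd)
        (hg.comp (Computable.fst.comp .snd))))
  refine h.of_eq fun n => ?_
  induction n with
  | zero => rfl
  | succ n ih => simp [List.range_succ, ← ih]

/-- Every string in `L` either extends one of the samples in `R`, or has value `q.2` at `q.1`. -/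
def ForcesValue (L : List (List Bool)) (R : List Sample) (q : ℕ × Bool) : Prop :=
  ∀ σ ∈ L, (∃ S ∈ R, ∀ p ∈ S, σ[p.1]? = some p.2) ∨ σ[q.1]? = some q.2

theorem primrecRel_forcesValue :
    PrimrecRel fun (L : List (List Bool)) (c : List Sample × (ℕ × Bool)) =>
      ForcesValue L c.1 c.2 := by
  have hval : PrimrecRel fun (p : ℕ × Bool) (σ : List Bool) => σ[p.1]? = some p.2 :=
    Primrec.eq.comp (Primrec.list_getElem?.comp .snd (Primrec.fst.comp .fst))
      (Primrec.option_some.comp (Primrec.snd.comp .fst))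
  have hext := hval.forall_mem_list.exists_mem_list
  have hor : PrimrecRel fun (σ : List Bool) (c : List Sample × (ℕ × Bool)) =>
      (∃ S ∈ c.1, ∀ p ∈ S, σ[p.1]? = some p.2) ∨ σ[c.2.1]? = some c.2.2 :=
    PrimrecPred.or (hext.comp (Primrec.fst.comp .snd) .fst)
      (hval.comp (Primrec.snd.comp .snd) .fst)
  exact hor.forall_mem_list

theorem isClopen_cyl (S : Sample) : IsClopen (Cyl S) := by
  have h : Cyl S = ⋂ p ∈ S.toFinset, {f : ℕ → Bool | f p.1 = p.2} := by
    ext f; simp [Cyl, Consistent]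
  rw [h]
  refine Set.Finite.isClopen_biInter (Finset.finite_toSet _) fun p _ => ?_
  exact (isClopen_discrete {p.2}).preimage (continuous_apply p.1)

open Classical in
theorem EffClosed.computable_of_singleton {f : ℕ → Bool} (hf : EffClosed {f}) :
    Computable f := by
  obtain ⟨g, hg, hfg⟩ := hf
  let P : ℕ → ℕ → Bool → Prop := fun b n v =>
    ForcesValue (bitStrings n) ((List.range n).map g) (b, v)
  have hP : ∀ v, Computable₂ fun b n => decide (P b n v) := by
    intro v
    have h := (PrimrecPred.decide primrecRel_forcesValue).to_comp
    exact h.comp (((primrec_bitStrings.to_comp).comp .snd).pair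
      (((computable_map_range hg).comp .snd).pair (Computable.fst.pair (.const v))))
  have hsound : ∀ {b n v}, P b n v → f b = v := by
    intro b n v h
    have hget : ∀ {i w}, ((List.range n).map f)[i]? = some w → f i = w := by
      intro i w hi
      simp only [List.getElem?_map, Option.map_eq_some_iff] at hi
      obtain ⟨a, ha, rfl⟩ := hi
      have := List.getElem?_eq_some_iff.1 ha
      obtain ⟨hlt, rfl⟩ := this
      simp
    rcases h ((List.range n).map f) (mem_bitStrings.2 (by simp)) with ⟨S, hS, hc⟩ | h
    · obtain ⟨t, -, rfl⟩ := List.mem_map.1 hS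
      have : f ∈ ({f} : Set (ℕ → Bool))ᶜ := by
        rw [hfg]
        exact Set.mem_iUnion.2 ⟨t, fun p hp => hget (hc p hp)⟩
      simp at this
    · exact hget h
  have hcomplete : ∀ b, ∃ n, P b n (f b) := by
    intro b
    have hcpt : IsCompact (Cyl [(b, !f b)]) := (isClopen_cyl _).1.isCompact
    obtain ⟨t, ht⟩ := hcpt.elim_finite_subcover (fun n => Cyl (g n))
      (fun n => (isClopen_cyl _).2) (by
        rw [← hfg]
        rintro h hh rfl
        simpa using hh (b, !h b) (by simp))
    obtain ⟨n, hn⟩ : ∃ n, b < n ∧ (∀ i ∈ t, i < n) ∧ ∀ i ∈ t, ∀ p ∈ g i, p.1 < n := by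
      obtain ⟨m, hm⟩ := (t.biUnion fun i => (g i).toFinset.image Prod.fst).bddAbove
      obtain ⟨k, hk⟩ := t.bddAbove
      refine ⟨b + m + k + 1, by omega, fun i hi => ?_, fun i hi p hp => ?_⟩
      · have := hk hi
        omega
      · have : p.1 ≤ m := hm (by
          simp only [Finset.coe_biUnion, Set.mem_iUnion, Finset.coe_image]
          exact ⟨i, hi, p, by simpa using hp, rfl⟩)
        omega
    refine ⟨n, fun σ hσ => ?_⟩
    rw [mem_bitStrings] at hσ
    let h : ℕ → Bool := fun i => σ.getD i false
    have hh : ∀ i < n, σ[i]? = some (h i) := by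
      intro i hi
      have : i < σ.length := by omega
      simp [h, this]
    by_cases hb : h b = f b
    · right
      rw [hh b hn.1, hb]
    · left
      have hmem : h ∈ Cyl [(b, !f b)] := by
        intro p hp
        obtain rfl : p = (b, !f b) := by simpa using hp
        simpa [Bool.eq_not_iff] using hb
      obtain ⟨i, hi, hc⟩ := Set.mem_iUnion₂.1 (ht hmem)
      refine ⟨g i, List.mem_map.2 ⟨i, by simpa using hn.2.1 i hi, rfl⟩, fun p hp => ?_⟩
      rw [hh _ (hn.2.2 i hi p hp), hc p hp]
  have hsearch : Partrec fun b => (Nat.rfind fun n =>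
      Part.some (decide (P b n true) || decide (P b n false))).map
        fun n => decide (P b n true) :=
    Partrec.map (Partrec.rfind (Computable₂.partrec₂
      (Primrec.or.to_comp.comp₂ (hP true) (hP false)))) (hP true)
  refine hsearch.of_eq_tot fun b => ?_
  obtain ⟨n, hn⟩ := hcomplete b
  obtain ⟨k, hk, -⟩ := Nat.rfind_min' (m := n)
    (p := fun n => decide (P b n true) || decide (P b n false)) (by
      revert hn
      cases f b <;> intro hn <;> simp [hn])
  refine Part.mem_map_iff _ |>.2 ⟨k, hk, ?_⟩
  have : true = (decide (P b k true) || decide (P b k false)) :=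
    Part.mem_some_iff.1 (Nat.rfind_spec hk)
  by_cases h1 : P b k true
  · simp [h1, hsound h1]
  · have h2 : P b k false := by simpa [h1] using this.symm
    simp [h1, hsound h2]

theorem EffClosed.inter_agree {X : Set (ℕ → Bool)} (hX : EffClosed X) (f : ℕ → Bool) (N : ℕ) :
    EffClosed {h ∈ X | ∀ x < N, h x = f x} := by
  induction N with
  | zero => simpa using hX
  | succ N ih =>
    obtain ⟨g, hg, hgX⟩ := ih
    refine ⟨fun n => Nat.casesOn n [(N, !f N)] g, ?_, ?_⟩
    · exact Computable.nat_casesOn Computable.id (.const _) (hg.comp .snd).to₂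
    · have key : ∀ h : ℕ → Bool, (h ∈ X ∧ ∀ x < N, h x = f x) ↔ ∀ n, h ∉ Cyl (g n) := by
        intro h
        have := congrArg (h ∈ ·) hgX
        simp only [Set.mem_compl_iff, Set.mem_ofPred_eq, Set.mem_iUnion, eq_iff_iff] at this
        rw [← not_exists, ← this, not_not]
      ext h
      rw [Set.mem_compl_iff, ← not_iff_not, not_not, Set.mem_iUnion, not_exists]
      have h0 : h ∉ Cyl [(N, !f N)] ↔ h N = f N := by
        simp [Cyl, Consistent]
      constructor
      · rintro ⟨hX, hN⟩ (_ | n)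
        · exact h0.2 (hN N (by omega))
        · exact (key h).1 ⟨hX, fun x hx => hN x (by omega)⟩ n
      · intro hn
        have h1 := (key h).2 fun n => hn (n + 1)
        refine ⟨h1.1, fun x hx => ?_⟩
        rcases Nat.lt_succ_iff_lt_or_eq.1 hx with hx | rfl
        · exact h1.2 x hx
        · exact h0.1 (hn 0)

/-- A member of an effectively closed set is computable if a finite part of it determines it. -/
theorem EffClosed.computable_of_isolated {X : Set (ℕ → Bool)} (hX : EffClosed X) {f : ℕ → Bool}
    (hf : f ∈ X) (N : ℕ) (h : ∀ h ∈ X, (∀ x < N, h x = f x) → h = f) : Computable f := by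
  refine EffClosed.computable_of_singleton ?_
  convert hX.inter_agree f N using 1
  ext k
  constructor
  · rintro rfl
    exact ⟨hf, fun _ _ => rfl⟩
  · exact fun hk => h k hk.1 hk.2

theorem EffClosed.computable_of_finite {X : Set (ℕ → Bool)} (hX : EffClosed X) (hfin : X.Finite)
    {f : ℕ → Bool} (hf : f ∈ X) : Computable f := by
  have hsep : ∀ h : ℕ → Bool, ∃ x, h ≠ f → h x ≠ f x := by
    intro h
    by_cases hh : h = f
    · exact ⟨0, fun h' => absurd hh h'⟩
    · obtain ⟨x, hx⟩ := Function.ne_iff.1 hh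
      exact ⟨x, fun _ => hx⟩
  choose d hd using hsep
  obtain ⟨M, hM⟩ := (hfin.image d).bddAbove
  refine hX.computable_of_isolated hf (M + 1) fun h hh hag => ?_
  by_contra hne
  exact hd h hne (hag _ (Nat.lt_succ_of_le (hM ⟨h, hh, rfl⟩)))

/-! ### Rejecting leaves of depth-two trees -/

/-- `A` picks, in the tree with root `t.1` and children `t.2.1` (edge `0`) and `t.2.2` (edge `1`),
a leaf whose branch is not realized by any function of `X`. -/
def RejectsLeaf (A : ℕ × ℕ × ℕ → Bool × Bool) (X : Set (ℕ → Bool)) : Prop :=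
  ∀ f ∈ X, ∀ t, ¬ (f t.1 = (A t).1 ∧ f (bif (A t).1 then t.2.2 else t.2.1) = (A t).2)

theorem EldimLe.exists_rejectsLeaf {H : Set (ℕ → Bool)} {d : ℕ} (hd : d ≤ 1) (h : EldimLe H d) :
    ∃ A, Computable A ∧ RejectsLeaf A H := by
  obtain ⟨B, hB, hBH⟩ := h
  let T : ℕ × ℕ × ℕ → TreeCode := fun t => [([], t.1), ([false], t.2.1), ([true], t.2.2)]
  have hT : Computable T := by
    refine Primrec.to_comp ?_
    have e : ∀ (p : List Bool) {k : ℕ × ℕ × ℕ → ℕ}, Primrec k →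
        Primrec fun t => ((p, k t) : List Bool × ℕ) := fun p _ hk => (Primrec.const p).pair hk
    exact Primrec.list_cons.comp (e _ .fst) (Primrec.list_cons.comp
      (e _ (Primrec.fst.comp .snd)) (Primrec.list_cons.comp
      (e _ (Primrec.snd.comp .snd)) (.const [])))
  have hget : ∀ i, Computable fun t => (B (T t)).getD i false := fun i =>
    (Primrec.list_getD false).to_comp.comp (hB.comp hT) (.const i)
  refine ⟨fun t => ((B (T t)).getD 0 false, (B (T t)).getD 1 false), (hget 0).pair (hget 1), ?_⟩
  rintro f hf t ⟨h1, h2⟩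
  obtain ⟨hlen, hrej⟩ := hBH (T t)
  apply hrej
  refine ⟨f, hf, ?_⟩
  dsimp only at h1 h2
  generalize B (T t) = p at *
  have hroot : nodeLabel (T t) [] = t.1 := by simp [nodeLabel, T, List.lookup]
  have hchild : ∀ i, nodeLabel (T t) [i] = bif i then t.2.2 else t.2.1 := by
    intro i
    cases i <;> simp [nodeLabel, T, List.lookup]
  interval_cases d
  · match p, hlen with
    | [i], _ =>
      simp [branchSample, Consistent, hroot, List.range_succ] at h1 ⊢
      exact h1
  · match p, hlen with
    | [i, j], _ =>
      simp [branchSample, Consistent, hroot, hchild, List.range_succ] at h1 h2 ⊢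
      exact ⟨h1, h2⟩

/-- The sample along the branch picked by `A` in the tree `t`. -/
def rejectedSample (A : ℕ × ℕ × ℕ → Bool × Bool) (t : ℕ × ℕ × ℕ) : Sample :=
  [(t.1, (A t).1), (bif (A t).1 then t.2.2 else t.2.1, (A t).2)]

/-- The functions realizing no branch picked by `A`. -/
def rejectionHull (A : ℕ × ℕ × ℕ → Bool × Bool) : Set (ℕ → Bool) :=
  {f | ∀ t, ¬ Consistent f (rejectedSample A t)}

theorem RejectsLeaf.subset_rejectionHull {A : ℕ × ℕ × ℕ → Bool × Bool} {X : Set (ℕ → Bool)}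
    (h : RejectsLeaf A X) : X ⊆ rejectionHull A :=
  fun f hf t ht => h f hf t (by simpa [Consistent, rejectedSample] using ht)

theorem rejectsLeaf_rejectionHull (A : ℕ × ℕ × ℕ → Bool × Bool) :
    RejectsLeaf A (rejectionHull A) :=
  fun f hf t ht => hf t (by simpa [Consistent, rejectedSample] using ht)

theorem effClosed_rejectionHull {A : ℕ × ℕ × ℕ → Bool × Bool} (hA : Computable A) :
    EffClosed (rejectionHull A) := by
  refine ⟨fun n => rejectedSample A (Denumerable.ofNat _ n), ?_, ?_⟩
  · have h : Computable (rejectedSample A) := by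
      have hsnd : Computable fun t : ℕ × ℕ × ℕ => bif (A t).1 then t.2.2 else t.2.1 :=
        Computable.cond (Computable.fst.comp hA) (Computable.snd.comp .snd)
          (Computable.fst.comp .snd)
      exact Computable.list_cons.comp (Computable.fst.pair (Computable.fst.comp hA))
        (Computable.list_cons.comp (hsnd.pair (Computable.snd.comp hA)) (.const []))
    exact h.comp (Computable.ofNat _)
  · ext f
    simp only [rejectionHull, Set.mem_compl_iff, Set.mem_ofPred_eq, not_forall, not_not,
      Set.mem_iUnion, Cyl]
    constructor
    · rintro ⟨t, ht⟩
      exact ⟨Encodable.encode t, by rwa [Denumerable.ofNat_encode]⟩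
    · rintro ⟨n, hn⟩
      exact ⟨_, hn⟩

/-- If two functions of `X` share the value `v` at `x` and differ at `b`, then the functions of `X`
that do not take the value `v` at `x` are determined by `A`. -/
theorem RejectsLeaf.eq_of_ne {A : ℕ × ℕ × ℕ → Bool × Bool} {X : Set (ℕ → Bool)}
    (h : RejectsLeaf A X) {u w f : ℕ → Bool} (hu : u ∈ X) (hw : w ∈ X) (hf : f ∈ X) {x b : ℕ}
    {v : Bool} (hux : u x = v) (hwx : w x = v) (hb : u b ≠ w b) (hfx : f x ≠ v) (c : ℕ) :
    f c = !(A (x, bif v then c else b, bif v then b else c)).2 := by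
  have h1 := h u hu (x, bif v then c else b, bif v then b else c)
  have h2 := h w hw (x, bif v then c else b, bif v then b else c)
  have h3 := h f hf (x, bif v then c else b, bif v then b else c)
  generalize A (x, bif v then c else b, bif v then b else c) = r at *
  obtain ⟨i, j⟩ := r
  simp only at h1 h2 h3 ⊢
  subst hux
  rw [hwx] at h2
  revert h1 h2 h3 hb hfx
  generalize u x = v
  generalize f x = v'
  cases v <;> cases v' <;> cases i <;> simp <;>
    generalize u b = p <;> generalize w b = q <;> revert p q j <;>
    generalize f c = r <;> revert r <;> decide

/-- Among three distinct functions, the majority vote `m` is at each point `y` shared by two of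
them, which differ at a point `b y`. -/
theorem exists_majority {g₁ g₂ g₃ : ℕ → Bool} (h₁₂ : g₁ ≠ g₂) (h₁₃ : g₁ ≠ g₃) (h₂₃ : g₂ ≠ g₃) :
    ∃ (m : ℕ → Bool) (b : ℕ → ℕ),
      (Computable g₁ → Computable g₂ → Computable g₃ → Computable m ∧ Computable b) ∧
      ∀ y, ∃ u ∈ ({g₁, g₂, g₃} : Set (ℕ → Bool)), ∃ w ∈ ({g₁, g₂, g₃} : Set (ℕ → Bool)),
        u y = m y ∧ w y = m y ∧ u (b y) ≠ w (b y) := by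
  obtain ⟨b₁₂, hb₁₂⟩ := Function.ne_iff.1 h₁₂
  obtain ⟨b₁₃, hb₁₃⟩ := Function.ne_iff.1 h₁₃
  obtain ⟨b₂₃, hb₂₃⟩ := Function.ne_iff.1 h₂₃
  refine ⟨fun y => bif g₁ y == g₂ y then g₁ y else g₃ y,
    fun y => bif g₁ y == g₂ y then b₁₂ else bif g₁ y == g₃ y then b₁₃ else b₂₃, ?_, ?_⟩
  · intro c₁ c₂ c₃
    have e₁₂ : Computable fun y => g₁ y == g₂ y := Primrec.beq.to_comp.comp c₁ c₂
    have e₁₃ : Computable fun y => g₁ y == g₃ y := Primrec.beq.to_comp.comp c₁ c₃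
    exact ⟨Computable.cond e₁₂ c₁ c₃,
      Computable.cond e₁₂ (.const _) (Computable.cond e₁₃ (.const _) (.const _))⟩
  · intro y
    by_cases e₁₂ : g₁ y = g₂ y
    · exact ⟨g₁, by simp, g₂, by simp, by simp [e₁₂], by simp [e₁₂], by simpa [e₁₂] using hb₁₂⟩
    · have e₁₂' : (g₁ y == g₂ y) = false := by simpa using e₁₂
      by_cases e₁₃ : g₁ y = g₃ y
      · refine ⟨g₁, by simp, g₃, by simp, ?_⟩
        simp only [e₁₂', cond_false]
        simpa [e₁₃] using hb₁₃
      · have e₁₃' : (g₁ y == g₃ y) = false := by simpa using e₁₃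
        refine ⟨g₂, by simp, g₃, by simp, ?_⟩
        simp only [e₁₂', e₁₃', cond_false]
        refine ⟨?_, trivial, hb₂₃⟩
        revert e₁₂ e₁₃
        cases g₁ y <;> cases g₂ y <;> cases g₃ y <;> simp

theorem Set.Infinite.exists_three {α : Type*} {X : Set α} (hX : X.Infinite) :
    ∃ a ∈ X, ∃ b ∈ X, ∃ c ∈ X, a ≠ b ∧ a ≠ c ∧ b ≠ c := by
  classical
  obtain ⟨t, ht, hcard⟩ := hX.exists_subset_card_eq 3
  obtain ⟨a, b, c, hab, hac, hbc, rfl⟩ := Finset.card_eq_three.1 hcard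
  exact ⟨a, ht (by simp), b, ht (by simp), c, ht (by simp), hab, hac, hbc⟩

theorem RejectsLeaf.exists_three_computable {A : ℕ × ℕ × ℕ → Bool × Bool} {X : Set (ℕ → Bool)}
    (h : RejectsLeaf A X) (hX : EffClosed X) (hinf : X.Infinite) :
    ∃ a ∈ X, ∃ b ∈ X, ∃ c ∈ X, (a ≠ b ∧ a ≠ c ∧ b ≠ c) ∧
      Computable a ∧ Computable b ∧ Computable c := by
  obtain ⟨g₁, hg₁, g₂, hg₂, g₃, hg₃, h₁₂, h₁₃, h₂₃⟩ := hinf.exists_three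
  obtain ⟨m, b, -, hm⟩ := exists_majority h₁₂ h₁₃ h₂₃
  have hsub : ({g₁, g₂, g₃} : Set (ℕ → Bool)) ⊆ X := by
    rintro g (rfl | rfl | rfl) <;> assumption
  have hcomp : ∀ f ∈ X \ {m}, Computable f := by
    rintro f ⟨hf, hfm⟩
    obtain ⟨x, hx⟩ := Function.ne_iff.1 hfm
    obtain ⟨u, hu, w, hw, hux, hwx, hb⟩ := hm x
    refine hX.computable_of_isolated hf (x + 1) fun k hk hag => funext fun c => ?_
    rw [h.eq_of_ne (hsub hu) (hsub hw) hf hux hwx hb hx c,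
      h.eq_of_ne (hsub hu) (hsub hw) hk hux hwx hb (by rwa [hag x (by omega)]) c]
  obtain ⟨p, hp, q, hq, r, hr, hne⟩ := (hinf.sdiff (Set.finite_singleton m)).exists_three
  exact ⟨p, hp.1, q, hq.1, r, hr.1, hne, hcomp p hp, hcomp q hq, hcomp r hr⟩

/-! ### Learners from a default hypothesis and corrections -/

/-- The point of the last among the first `n` entries of `S` that disagree with `m`, if any. -/
def disagreement (m : ℕ → Bool) (S : Sample) (n : ℕ) : Option ℕ :=
  Nat.rec none (fun i acc =>
    bif S[i]?.elim false (fun p => p.2 ^^ m p.1) then S[i]?.map Prod.fst else acc) n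

theorem computable_disagreement {m : ℕ → Bool} (hm : Computable m) :
    Computable fun S : Sample => disagreement m S S.length := by
  have hget : Computable fun q : Sample × (ℕ × Option ℕ) => q.1[q.2.1]? :=
    Computable.list_getElem?.comp .fst (Computable.fst.comp .snd)
  have hx : Computable fun p : ℕ × Bool => p.2 ^^ m p.1 :=
    (Primrec.dom_bool₂ xor).to_comp.comp .snd (hm.comp .fst)
  have htest : Computable fun q : Sample × (ℕ × Option ℕ) =>
      q.1[q.2.1]?.elim false (fun p => p.2 ^^ m p.1) := by
    refine (Computable.option_casesOn hget (.const false) (hx.comp .snd).to₂).of_eq fun q => ?_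
    cases q.1[q.2.1]? <;> rfl
  exact Computable.nat_rec (f := List.length) (g := fun _ => none)
    (h := fun (S : Sample) (q : ℕ × Option ℕ) =>
      bif S[q.1]?.elim false (fun p => p.2 ^^ m p.1) then S[q.1]?.map Prod.fst else q.2)
    .list_length (.const none) (Computable.to₂ (Computable.cond htest
      (Computable.option_map hget (Computable.fst.comp .snd).to₂) (Computable.snd.comp .snd)))

theorem disagreement_spec (m : ℕ → Bool) (S : Sample) (n : ℕ) :
    (∀ y, disagreement m S n = some y → ∃ p ∈ S, p.1 = y ∧ p.2 ≠ m y) ∧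
      (disagreement m S n = none → ∀ i < n, ∀ p, S[i]? = some p → p.2 = m p.1) := by
  induction n with
  | zero => simp [disagreement]
  | succ n ih =>
    have hstep : disagreement m S (n + 1) =
        bif S[n]?.elim false (fun p => p.2 ^^ m p.1) then S[n]?.map Prod.fst
        else disagreement m S n := rfl
    rw [hstep]
    rcases hS : S[n]? with _ | p
    · simp only [Option.elim_none, cond_false]
      refine ⟨ih.1, fun h i hi p hp => ?_⟩
      rcases Nat.lt_succ_iff_lt_or_eq.1 hi with hi | rfl
      · exact ih.2 h i hi p hp
      · simp [hS] at hp
    · by_cases hp : p.2 = m p.1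
      · simp only [Option.elim_some, hp, Bool.xor_self, cond_false]
        refine ⟨ih.1, fun h i hi q hq => ?_⟩
        rcases Nat.lt_succ_iff_lt_or_eq.1 hi with hi | rfl
        · exact ih.2 h i hi q hq
        · obtain rfl : p = q := by simpa [hS] using hq
          exact hp
      · have hx : (p.2 ^^ m p.1) = true := by simpa using hp
        simp only [Option.elim_some, hx, cond_true, Option.map_some]
        refine ⟨?_, by simp⟩
        rintro y ⟨⟩
        exact ⟨p, List.mem_of_getElem? hS, rfl, hp⟩

theorem countP_range_le_one {n : ℕ} {P : ℕ → Bool}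
    (h : ∀ i < n, ∀ j < i, P i = true → P j = true → False) : (List.range n).countP P ≤ 1 := by
  rw [List.countP_eq_length_filter]
  by_contra! hlt
  have hs : ((List.range n).filter P).Pairwise (· < ·) := List.pairwise_lt_range.filter _
  have h01 := List.pairwise_iff_getElem.1 hs 0 1 (by omega) hlt (by omega)
  have h0 := List.mem_filter.1 (List.getElem_mem (l := (List.range n).filter P) (n := 0) (by omega))
  have h1 := List.mem_filter.1 (List.getElem_mem (l := (List.range n).filter P) (n := 1) hlt)
  exact h _ (by simpa using h1.1) _ h01 h1.2 h0.2

/-- If every `f ∈ H` that deviates from `m` at `y` equals `u y`, for computable `m` and `u`, then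
predicting with `m` until the first disagreement, and with `u` afterwards, errs at most once. -/
theorem exists_learner {H : Set (ℕ → Bool)} {m : ℕ → Bool} {u : ℕ → ℕ → Bool}
    (hm : Computable m) (hu : Computable₂ u) (h : ∀ f ∈ H, ∀ y, f y ≠ m y → ∀ x, f x = u y x) :
    ∃ L : Learner, Computable₂ L ∧ ∀ S : Sample, Realizable H S → mistakes L S ≤ 1 := by
  refine ⟨fun S x => Option.casesOn (disagreement m S S.length) (m x) (fun y => u y x), ?_, ?_⟩
  · exact Computable.option_casesOn ((computable_disagreement hm).comp .fst) (hm.comp .snd)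
      (Computable.to₂ (hu.comp .snd (Computable.snd.comp .fst)))
  · rintro S ⟨f, hf, hfS⟩
    have key : ∀ i, i < S.length →
        Option.casesOn (disagreement m (S.take i) (S.take i).length)
          (m (S.getD i (0, false)).1) (fun y => u y (S.getD i (0, false)).1) ≠
          (S.getD i (0, false)).2 →
        (S.getD i (0, false)).2 ≠ m (S.getD i (0, false)).1 ∧
          ∀ j < i, (S.getD j (0, false)).2 = m (S.getD j (0, false)).1 := by
      intro i hi
      obtain ⟨hsome, hnone⟩ := disagreement_spec m (S.take i) (S.take i).length
      have hval : f (S.getD i (0, false)).1 = (S.getD i (0, false)).2 := by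
        have : S.getD i (0, false) ∈ S := by simp [hi]
        exact hfS _ this
      rcases hd : disagreement m (S.take i) (S.take i).length with _ | y
      · intro hne
        refine ⟨fun h' => hne h'.symm, fun j hj => ?_⟩
        have hj' : j < S.length := by omega
        refine hnone hd j (by simp; omega) _ ?_
        simp [hj, hj']
      · intro hne
        obtain ⟨p, hp, rfl, hpm⟩ := hsome y hd
        have hfp := hfS p (List.mem_of_mem_take hp)
        exact absurd ((h f hf p.1 (by rwa [hfp]) _).symm.trans hval) hne
    refine countP_range_le_one fun i hi j hj h1 h2 => ?_
    simp only [decide_eq_true_eq] at h1 h2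
    exact (key j (by omega) h2).1 ((key i hi h1).2 j hj)

theorem RejectsLeaf.exists_learner_of_three {A : ℕ × ℕ × ℕ → Bool × Bool} {X : Set (ℕ → Bool)}
    (hA : Computable A) (h : RejectsLeaf A X) {g₁ g₂ g₃ : ℕ → Bool} (hg₁ : g₁ ∈ X) (hg₂ : g₂ ∈ X)
    (hg₃ : g₃ ∈ X) (h₁₂ : g₁ ≠ g₂) (h₁₃ : g₁ ≠ g₃) (h₂₃ : g₂ ≠ g₃) (c₁ : Computable g₁)
    (c₂ : Computable g₂) (c₃ : Computable g₃) :
    ∃ L : Learner, Computable₂ L ∧ ∀ S : Sample, Realizable X S → mistakes L S ≤ 1 := by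
  obtain ⟨m, b, hmb, hm⟩ := exists_majority h₁₂ h₁₃ h₂₃
  obtain ⟨cm, cb⟩ := hmb c₁ c₂ c₃
  have hsub : ({g₁, g₂, g₃} : Set (ℕ → Bool)) ⊆ X := by
    rintro g (rfl | rfl | rfl) <;> assumption
  refine exists_learner (m := m)
    (u := fun y x => !(A (y, bif m y then x else b y, bif m y then b y else x)).2) cm ?_ ?_
  · have cm' : Computable fun q : ℕ × ℕ => m q.1 := cm.comp .fst
    have cb' : Computable fun q : ℕ × ℕ => b q.1 := cb.comp .fst
    exact Primrec.not.to_comp.comp (Computable.snd.comp (hA.comp (Computable.fst.pair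
      ((Computable.cond cm' .snd cb').pair (Computable.cond cm' cb' .snd)))))
  · intro f hf y hy x
    obtain ⟨u, hu, w, hw, huy, hwy, hb⟩ := hm y
    exact h.eq_of_ne (hsub hu) (hsub hw) hf huy hwy hb hy x

theorem RejectsLeaf.exists_learner {A : ℕ × ℕ × ℕ → Bool × Bool} {X : Set (ℕ → Bool)}
    (hA : Computable A) (h : RejectsLeaf A X) (hX : EffClosed X) (hne : X.Nonempty) :
    ∃ L : Learner, Computable₂ L ∧ ∀ S : Sample, Realizable X S → mistakes L S ≤ 1 := by
  by_cases hinf : X.Infinite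
  · obtain ⟨a, ha, b, hb, c, hc, ⟨hab, hac, hbc⟩, ca, cb, cc⟩ := h.exists_three_computable hX hinf
    exact h.exists_learner_of_three hA ha hb hc hab hac hbc ca cb cc
  have hcomp : ∀ f ∈ X, Computable f := fun f hf =>
    hX.computable_of_finite (Set.not_infinite.1 hinf) hf
  by_cases hpair : ∃ a ∈ X, ∃ b ∈ X, ∀ f ∈ X, f = a ∨ f = b
  · obtain ⟨a, ha, b, hb, hab⟩ := hpair
    refine _root_.exists_learner (hcomp a ha) (u := fun _ => b)
      ((hcomp b hb).comp .snd).to₂ fun f hf y hy x => ?_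
    rcases hab f hf with rfl | rfl
    · exact absurd rfl hy
    · rfl
  · push Not at hpair
    obtain ⟨a, ha⟩ := hne
    obtain ⟨b, hb, hba, -⟩ := hpair a ha a ha
    obtain ⟨c, hc, hca, hcb⟩ := hpair a ha b hb
    exact h.exists_learner_of_three hA ha hb hc hba.symm hca.symm hcb.symm
      (hcomp a ha) (hcomp b hb) (hcomp c hc)

theorem exists_eldimLe_of_eldim_le_one {H : Set (ℕ → Bool)} (h : Eldim H ≤ 1) :
    ∃ d ≤ 1, EldimLe H d := by
  have hne : (((↑) : ℕ → ℕ∞) '' {d : ℕ | EldimLe H d}).Nonempty := by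
    rw [Set.nonempty_iff_ne_empty]
    intro hempty
    rw [Eldim, hempty, sInf_empty] at h
    simp at h
  obtain ⟨d, hd, hdeq⟩ := csInf_mem hne
  refine ⟨d, ?_, hd⟩
  rw [Eldim, ← hdeq] at h
  exact_mod_cast h

theorem stmt17 (H : Set (ℕ → Bool)) (hne : H.Nonempty) (h : Eldim H ≤ 1) :
    ∃ L : Learner, Computable₂ L ∧ ∀ S : Sample, Realizable H S → mistakes L S ≤ 1 := by
  obtain ⟨d, hd, hHd⟩ := exists_eldimLe_of_eldim_le_one h
  obtain ⟨A, hA, hAH⟩ := hHd.exists_rejectsLeaf hd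
  have hsub := hAH.subset_rejectionHull
  obtain ⟨L, hL, hmist⟩ := (rejectsLeaf_rejectionHull A).exists_learner hA
    (effClosed_rejectionHull hA) (hne.mono hsub)
  exact ⟨L, hL, fun S ⟨f, hf, hfS⟩ => hmist S ⟨f, hsub hf, hfS⟩⟩
end
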